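/- There does not exist a $(v,3;k_1,k_2,k_3;\lambda_1,\lambda_2,\lambda_3)$-GSEDF in any finite abelian group of order $v$ when $k_1+k_2+k_3 < v$. -/

import Mathlib

/-- The number of times `g` occurs in the multiset `Δ(A,B) = {x - y : x ∈ A, y ∈ B}`. -/
noncomputable def extDiffCount {G : Type*} [AddCommGroup G] (A B : Finset G) (g : G) : ℕ :=
  letI := Classical.decEq G
  ((A ×ˢ B).filter (fun p => p.1 - p.2 = g)).card

/-- `{D i}` is a `(v, m; k₁,…,k_m; λ₁,…,λ_m)`-GSEDF in the finite abelian group `G`. -/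
def IsGSEDF {G : Type*} [AddCommGroup G] [Fintype G] (v m : ℕ)
    (D : Fin m → Finset G) (k lam : Fin m → ℕ) : Prop :=
  Fintype.card G = v ∧
  (∀ i, (D i).card = k i) ∧
  (∀ i, 0 < k i) ∧ (∀ i, 0 < lam i) ∧
  (∀ i j, i ≠ j → Disjoint (D i) (D j)) ∧
  ∀ i, ∀ g : G, g ≠ 0 →
    (∑ j ∈ Finset.univ.filter (· ≠ i), extDiffCount (D i) (D j) g) = lam i



open Finset ComplexConjugate

lemma extDiff_sum {G : Type*} [AddCommGroup G] [Fintype G] (A B : Finset G) (χ : AddChar G ℂ) :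
    ∑ g : G, (extDiffCount A B g : ℂ) * χ g = (∑ x ∈ A, χ x) * conj (∑ y ∈ B, χ y) := by
  classical
  have h1 : ∀ g : G, (extDiffCount A B g : ℂ) * χ g
      = ∑ p ∈ A ×ˢ B, if p.1 - p.2 = g then χ (p.1 - p.2) else 0 := by
    intro g
    rw [← Finset.sum_filter]
    rw [Finset.sum_congr rfl (g := fun _ => χ g)]
    · rw [Finset.sum_const, nsmul_eq_mul]
      unfold extDiffCount
      congr 3
    · intro p hp
      rw [(Finset.mem_filter.mp hp).2]
  rw [Finset.sum_congr rfl (fun g _ => h1 g), Finset.sum_comm, map_sum, Finset.sum_mul_sum,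
    ← Finset.sum_product' (f := fun i j => χ i * conj (χ j))]
  refine Finset.sum_congr rfl fun p _ => ?_
  rw [Finset.sum_ite_eq, if_pos (Finset.mem_univ _), sub_eq_add_neg, AddChar.map_add_eq_mul,
    AddChar.map_neg_eq_conj]

lemma extDiff_zero {G : Type*} [AddCommGroup G] (A B : Finset G) (h : Disjoint A B) :
    extDiffCount A B 0 = 0 := by
  classical
  unfold extDiffCount
  rw [Finset.card_eq_zero, Finset.filter_eq_empty_iff]
  rintro ⟨x, y⟩ hp hxy
  rw [Finset.mem_product] at hp
  have : x = y := sub_eq_zero.mp hxy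
  exact (Finset.disjoint_left.mp h hp.1) (this ▸ hp.2)

lemma char_pair {G : Type*} [AddCommGroup G] [Fintype G] (A B C : Finset G) (l : ℕ)
    (hB : Disjoint A B) (hC : Disjoint A C)
    (h : ∀ g : G, g ≠ 0 → extDiffCount A B g + extDiffCount A C g = l) (χ : AddChar G ℂ) :
    (∑ x ∈ A, χ x) * conj (∑ x ∈ B, χ x + ∑ x ∈ C, χ x) = l * (∑ g : G, χ g - 1) := by
  classical
  rw [map_add, mul_add, ← extDiff_sum, ← extDiff_sum, ← Finset.sum_add_distrib]
  have h1 : ∀ g : G, (extDiffCount A B g : ℂ) * χ g + (extDiffCount A C g : ℂ) * χ g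
      = l * χ g - if g = 0 then (l : ℂ) else 0 := by
    intro g
    by_cases hg : g = 0
    · subst hg
      simp [extDiff_zero A B hB, extDiff_zero A C hC]
    · rw [if_neg hg, ← add_mul, ← h g hg]
      push_cast
      ring
  rw [Finset.sum_congr rfl (fun g _ => h1 g), Finset.sum_sub_distrib, ← Finset.mul_sum]
  simp
  ring

lemma real_core (N r1 r2 r3 l1 l2 l3 : ℝ) (hN : 0 < N) (hs : r1 + r2 + r3 = N)
    (h1 : r1 ^ 2 = (r1 + l1) * N) (h2 : r2 ^ 2 = (r2 + l2) * N) (h3 : r3 ^ 2 = (r3 + l3) * N)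
    (t1 : l1 < l2 + l3) (t2 : l2 < l1 + l3) (t3 : l3 < l1 + l2) : False := by
  subst hs
  have a : r1 * r2 < 0 := by nlinarith [mul_pos hN (sub_pos.mpr t3)]
  have b : r1 * r3 < 0 := by nlinarith [mul_pos hN (sub_pos.mpr t2)]
  have c : r2 * r3 < 0 := by nlinarith [mul_pos hN (sub_pos.mpr t1)]
  have := mul_pos_of_neg_of_neg a b
  nlinarith [mul_neg_of_pos_of_neg this c, sq_nonneg (r1 * r2 * r3)]

lemma complex_core (a b c : ℂ) (l1 l2 l3 : ℝ)
    (h1 : a * conj (b + c) = -l1) (h2 : b * conj (a + c) = -l2) (h3 : c * conj (a + b) = -l3)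
    (t1 : l1 < l2 + l3) (t2 : l2 < l1 + l3) (t3 : l3 < l1 + l2) : a + b + c = 0 := by
  by_contra hne
  have key : ∀ x y : ℂ, ∀ l : ℝ, x * conj y = -l →
      x * conj (x + y) = ((Complex.normSq x - l : ℝ) : ℂ) := by
    intro x y l h
    rw [map_add, mul_add, h, Complex.mul_conj]
    push_cast
    ring
  have key2 : ∀ x y : ℂ, ∀ l : ℝ, x * conj y = -l →
      (Complex.normSq x - l) ^ 2 = ((Complex.normSq x - l) + l) * Complex.normSq (x + y) := by
    intro x y l h
    have := congrArg Complex.normSq (key x y l h)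
    rw [Complex.normSq_mul, Complex.normSq_conj, Complex.normSq_ofReal] at this
    rw [sub_add_cancel, this, sq]
  have e2 : b + (a + c) = a + b + c := by ring
  have e3 : c + (a + b) = a + b + c := by ring
  have q1 := key2 _ _ _ h1
  have q2 := key2 _ _ _ h2
  have q3 := key2 _ _ _ h3
  have p1 := key _ _ _ h1
  have p2 := key _ _ _ h2
  have p3 := key _ _ _ h3
  rw [← add_assoc] at q1 p1
  rw [e2] at q2 p2
  rw [e3] at q3 p3
  refine real_core _ _ _ _ l1 l2 l3 (Complex.normSq_pos.mpr hne) ?_ q1 q2 q3 t1 t2 t3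
  have : (a + b + c) * conj (a + b + c) = _ := Complex.mul_conj _
  rw [add_mul, add_mul, p1, p2, p3] at this
  exact_mod_cast this

/-- no `(v, 3; k₁,k₂,k₃; λ₁,λ₂,λ₃)`-GSEDF exists when `k₁ + k₂ + k₃ < v`. -/
theorem gsedf_three_nonexistence {G : Type*} [AddCommGroup G] [Fintype G] (v : ℕ)
    (D : Fin 3 → Finset G) (k lam : Fin 3 → ℕ)
    (hlt : k 0 + k 1 + k 2 < v) :
    ¬ IsGSEDF v 3 D k lam := by
  classical
  rintro ⟨hv, hk, hkpos, -, hdisj, hD⟩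
  have d01 := hdisj 0 1 (by decide)
  have d02 := hdisj 0 2 (by decide)
  have d12 := hdisj 1 2 (by decide)
  have f0 : (Finset.univ.filter (· ≠ (0 : Fin 3))) = {1, 2} := by decide
  have f1 : (Finset.univ.filter (· ≠ (1 : Fin 3))) = {0, 2} := by decide
  have f2 : (Finset.univ.filter (· ≠ (2 : Fin 3))) = {0, 1} := by decide
  have c0 := char_pair (D 0) (D 1) (D 2) (lam 0) d01 d02 (fun g hg => by
    have := hD 0 g hg
    rwa [f0, Finset.sum_pair (by decide)] at this)
  have c1 := char_pair (D 1) (D 0) (D 2) (lam 1) d01.symm d12 (fun g hg => by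
    have := hD 1 g hg
    rwa [f1, Finset.sum_pair (by decide)] at this)
  have c2 := char_pair (D 2) (D 0) (D 1) (lam 2) d02.symm d12.symm (fun g hg => by
    have := hD 2 g hg
    rwa [f2, Finset.sum_pair (by decide)] at this)
  have n0 := c0 1
  have n1 := c1 1
  have n2 := c2 1
  simp only [AddChar.one_apply, Finset.sum_const, hk, nsmul_eq_mul, mul_one, Finset.card_univ, hv,
    map_add, map_natCast] at n0 n1 n2
  have m0 : (k 0 : ℝ) * (k 1 + k 2) = lam 0 * (v - 1) := by exact_mod_cast n0
  have m1 : (k 1 : ℝ) * (k 0 + k 2) = lam 1 * (v - 1) := by exact_mod_cast n1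
  have m2 : (k 2 : ℝ) * (k 0 + k 1) = lam 2 * (v - 1) := by exact_mod_cast n2
  have k0 : (0 : ℝ) < k 0 := by exact_mod_cast hkpos 0
  have k1 : (0 : ℝ) < k 1 := by exact_mod_cast hkpos 1
  have k2 : (0 : ℝ) < k 2 := by exact_mod_cast hkpos 2
  have hv1 : (0 : ℝ) < v - 1 := by
    have : 1 < v := by have := hkpos 0; have := hkpos 1; omega
    have : (1 : ℝ) < v := by exact_mod_cast this
    linarith
  have t0 : (lam 0 : ℝ) < lam 1 + lam 2 := by
    refine lt_of_mul_lt_mul_right ?_ hv1.le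
    nlinarith [mul_pos k1 k2]
  have t1 : (lam 1 : ℝ) < lam 0 + lam 2 := by
    refine lt_of_mul_lt_mul_right ?_ hv1.le
    nlinarith [mul_pos k0 k2]
  have t2 : (lam 2 : ℝ) < lam 0 + lam 1 := by
    refine lt_of_mul_lt_mul_right ?_ hv1.le
    nlinarith [mul_pos k0 k1]
  have hzero : ∀ χ : AddChar G ℂ, χ ≠ 1 →
      ∑ x ∈ D 0, χ x + ∑ x ∈ D 1, χ x + ∑ x ∈ D 2, χ x = 0 := by
    intro χ hχ
    have hs : ∑ g : G, χ g = 0 := AddChar.sum_eq_zero_of_ne_one hχ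
    refine complex_core _ _ _ (lam 0) (lam 1) (lam 2) ?_ ?_ ?_ t0 t1 t2
    · rw [c0, hs]; simp
    · rw [c1, hs]; simp
    · rw [c2, hs]; simp
  -- pick an element outside the union
  obtain ⟨g, hg⟩ : ∃ g, g ∉ D 0 ∪ D 1 ∪ D 2 := by
    by_contra! hall
    have h1 : (Finset.univ : Finset G).card ≤ (D 0 ∪ D 1 ∪ D 2).card :=
      Finset.card_le_card fun g _ => hall g
    have h2 := Finset.card_union_le (D 0 ∪ D 1) (D 2)
    have h3 := Finset.card_union_le (D 0) (D 1)
    rw [Finset.card_univ, hv] at h1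
    rw [hk] at h2
    rw [hk, hk] at h3
    omega
  simp only [Finset.mem_union, not_or] at hg
  have hout : ∀ i, g ∉ D i → ∑ χ : AddChar G ℂ, (∑ x ∈ D i, χ x) * χ (-g) = 0 := by
    intro i hi
    simp_rw [Finset.sum_mul, ← AddChar.map_add_eq_mul]
    rw [Finset.sum_comm]
    refine Finset.sum_eq_zero fun x hx => ?_
    rw [AddChar.sum_apply_eq_ite, if_neg]
    intro h
    exact hi ((add_neg_eq_zero.mp h) ▸ hx)
  have htot : ∑ χ : AddChar G ℂ,
      (∑ x ∈ D 0, χ x + ∑ x ∈ D 1, χ x + ∑ x ∈ D 2, χ x) * χ (-g) = 0 := by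
    simp_rw [add_mul, Finset.sum_add_distrib]
    rw [hout 0 hg.1.1, hout 1 hg.1.2, hout 2 hg.2]
    simp
  rw [Finset.sum_eq_single (1 : AddChar G ℂ) (fun χ _ hχ => by rw [hzero χ hχ, zero_mul])
    (by simp)] at htot
  simp only [AddChar.one_apply, Finset.sum_const, hk, nsmul_eq_mul, mul_one] at htot
  have : k 0 + k 1 + k 2 = 0 := by exact_mod_cast htot
  have := hkpos 0
  omega
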